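/- arXiv:0812.0444 — 2 statements merged into one kernel-verified Lean document; each statement's English description precedes it below -/
import Mathlib

section
/- Let ⋆ be a semistar operation on an integral domain D. If D is a Prüfer ⋆-multiplication domain (P⋆MD) and every quasi-⋆̃-prime ideal of D has finite height (D is ⋆̃-locally finite dimensional), then D is ⋆̃-universally catenarian, i.e., D[X₁,…,Xₙ] is ⋆[n]-catenary for every n ≥ 1. -/
/- ## Preliminaries: general ideal-chain notions in a commutative ring -/

open Pointwise

section ChainNotions

variable {A B : Type*} [CommRing A] [CommRing B]

/-- `P` and `Q` are adjacent with respect to the class `Φ` of ideals: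
`P ⊂ Q` and no ideal of the class `Φ` lies strictly between them. -/
def AdjacentFor (Φ : Ideal A → Prop) (P Q : Ideal A) : Prop :=
  P < Q ∧ ∀ I : Ideal A, Φ I → ¬(P < I ∧ I < Q)

/-- A saturated chain, consisting of ideals of the class `Φ`, of length `m`
between `P` and `Q` (saturated: consecutive members are `Φ`-adjacent). -/
def SaturatedChainFor (Φ : Ideal A → Prop) (P Q : Ideal A) (m : ℕ) : Prop :=
  ∃ c : Fin (m + 1) → Ideal A, StrictMono c ∧ c 0 = P ∧ c (Fin.last m) = Q ∧
    (∀ i, Φ (c i)) ∧ ∀ i : Fin m, AdjacentFor Φ (c i.castSucc) (c i.succ)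

/-- Catenarity with respect to the class `Φ` of ideals: for every pair `P ⊂ Q` of
`Φ`-ideals, any two saturated chains of `Φ`-ideals between `P` and `Q` have the
same (finite) length. -/
def CatenaryFor (Φ : Ideal A → Prop) : Prop :=
  ∀ P Q : Ideal A, Φ P → Φ Q → P < Q →
    ∀ m₁ m₂ : ℕ, SaturatedChainFor Φ P Q m₁ → SaturatedChainFor Φ P Q m₂ → m₁ = m₂

/-- A chain `(0) = P₀ ⊂ P₁ ⊂ ⋯ ⊂ Pₙ` with all `Pᵢ`, `1 ≤ i ≤ n`, in the class `Φ`. -/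
def DimChainFor (Φ : Ideal A → Prop) (n : ℕ) : Prop :=
  ∃ c : Fin (n + 1) → Ideal A, StrictMono c ∧ c 0 = ⊥ ∧ ∀ i, i ≠ 0 → Φ (c i)

/-- The dimension associated to the class `Φ` of (quasi-prime) ideals: the supremum of
the lengths of chains `(0) = P₀ ⊂ P₁ ⊂ ⋯ ⊂ Pₙ` with all `Pᵢ` (`i ≥ 1`) in `Φ`. -/
noncomputable def quasiDim (Φ : Ideal A → Prop) : ℕ∞ :=
  ⨆ (n : ℕ) (_ : DimChainFor Φ n), (n : ℕ∞)

/-- The height of an ideal `P`: the supremum of lengths of strict chains of prime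
ideals ending at `P`. -/
noncomputable def idealHeight (P : Ideal A) : ℕ∞ :=
  ⨆ (n : ℕ) (_ : ∃ c : Fin (n + 1) → Ideal A, StrictMono c ∧ (∀ i, (c i).IsPrime) ∧
      c (Fin.last n) = P), (n : ℕ∞)

/-- The Krull dimension of a commutative ring, as the supremum in `ℕ∞` of the lengths
of strict chains of prime ideals. -/
noncomputable def krullDimE (A : Type*) [CommRing A] : ℕ∞ :=
  ⨆ (n : ℕ) (_ : ∃ c : Fin (n + 1) → Ideal A, StrictMono c ∧ ∀ i, (c i).IsPrime), (n : ℕ∞)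

/-- Every pair of `Φ`-adjacent `Φ`-ideals `P ⊂ Q` of `A` extends, along `f : A →+* B`,
to a pair of `Ψ`-adjacent `Ψ`-ideals `P.map f ⊂ Q.map f` of `B`. -/
def ExtendsAdjacent (f : A →+* B) (Φ : Ideal A → Prop) (Ψ : Ideal B → Prop) : Prop :=
  ∀ P Q : Ideal A, Φ P → Φ Q → AdjacentFor Φ P Q →
    Ψ (Ideal.map f P) ∧ Ψ (Ideal.map f Q) ∧ AdjacentFor Ψ (Ideal.map f P) (Ideal.map f Q)

/-- A (classically) catenary ring: any two saturated chains of primes between a fixed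
pair of primes `P ⊂ Q` have the same finite length. -/
def IsCatenaryRing (A : Type*) [CommRing A] : Prop :=
  CatenaryFor (fun I : Ideal A => I.IsPrime)

/-- A (classical) S-domain: every height-one prime `P` extends to a height-one prime
`P[X]` of the polynomial ring. -/
def IsSDomain (A : Type*) [CommRing A] : Prop :=
  ∀ P : Ideal A, P.IsPrime → idealHeight P = 1 →
    idealHeight (Ideal.map (Polynomial.C : A →+* Polynomial A) P) = 1

/-- A (classical) strong S-domain: every pair of adjacent primes `P ⊂ Q` extends to a
pair of adjacent primes `P[X] ⊂ Q[X]` of the polynomial ring. -/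
def IsStrongSDomain (A : Type*) [CommRing A] : Prop :=
  ExtendsAdjacent (Polynomial.C : A →+* Polynomial A)
    (fun I : Ideal A => I.IsPrime) (fun I : Ideal (Polynomial A) => I.IsPrime)

/-- A (classical) stably strong S-domain: `A[X₁,…,Xₙ]` is a strong S-domain for all `n ≥ 1`. -/
def IsStablyStrongSDomain (A : Type*) [CommRing A] : Prop :=
  ∀ n : ℕ, 1 ≤ n → IsStrongSDomain (MvPolynomial (Fin n) A)

/-- A (classical) Jaffard domain: finite Krull dimension, and
`dim (A[X₁,…,Xₙ]) = dim A + n` for all `n ≥ 1`. -/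
def IsJaffardDomain (A : Type*) [CommRing A] : Prop :=
  krullDimE A ≠ ⊤ ∧ ∀ n : ℕ, 1 ≤ n → krullDimE (MvPolynomial (Fin n) A) = krullDimE A + n

end ChainNotions

/- ## Semistar operations -/

section Semistar

variable (R : Type*) (F : Type*) [CommRing R] [Field F] [Algebra R F]

instance (priority := 100) : SMulCommClass F R F := SMulCommClass.symm R F F

/-- A semistar operation on a domain `R` with quotient field `F`: an operation on the
(nonzero) `R`-submodules of `F` satisfying `(xE)^⋆ = x E^⋆`, monotonicity, extensivity
and idempotency. (The value on the zero submodule is irrelevant.) -/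
structure SemistarOp where
  /-- the underlying map on `R`-submodules of `F` -/
  star : Submodule R F → Submodule R F
  star_smul : ∀ x : F, x ≠ 0 → ∀ E : Submodule R F, E ≠ ⊥ → star (x • E) = x • star E
  star_mono : ∀ E G : Submodule R F, E ≠ ⊥ → G ≠ ⊥ → E ≤ G → star E ≤ star G
  le_star : ∀ E : Submodule R F, E ≠ ⊥ → E ≤ star E
  star_idem : ∀ E : Submodule R F, E ≠ ⊥ → star (star E) = star E

variable {R F}

/-- The extension of an ideal of `R` to an `R`-submodule of `F`. -/
def idealExt (I : Ideal R) : Submodule R F := Submodule.map (Algebra.linearMap R F) I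

/-- The contraction to `R` of an `R`-submodule of `F` (i.e. `E ∩ R`). -/
def idealCon (E : Submodule R F) : Ideal R := Submodule.comap (Algebra.linearMap R F) E

/-- The finite-type semistar operation `⋆_f` associated to `⋆`:
`E^{⋆_f}` is the union of `G^⋆` over all nonzero finitely generated `G ⊆ E`
(the family is directed, so the union is the supremum). -/
noncomputable def SemistarOp.ft (s : SemistarOp R F) (E : Submodule R F) : Submodule R F :=
  ⨆ (G : Submodule R F) (_ : G.FG ∧ G ≠ ⊥ ∧ G ≤ E), s.star G

/-- `I` is a quasi-`f`-ideal (for `f` a semistar-type operation, e.g. `s.star`, `s.ft`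
or `s.tilde`): `I` is nonzero and `f(I) ∩ R = I`. -/
def IsQuasiIdeal (f : Submodule R F → Submodule R F) (I : Ideal R) : Prop :=
  I ≠ ⊥ ∧ idealCon (f (idealExt I)) = I

/-- A quasi-prime: a prime quasi-ideal. -/
def IsQuasiPrime (f : Submodule R F → Submodule R F) (I : Ideal R) : Prop :=
  I.IsPrime ∧ IsQuasiIdeal f I

/-- A quasi-maximal ideal: maximal among proper quasi-ideals. -/
def IsQuasiMax (f : Submodule R F → Submodule R F) (I : Ideal R) : Prop :=
  IsQuasiIdeal f I ∧ I ≠ ⊤ ∧ ∀ J : Ideal R, IsQuasiIdeal f J → J ≠ ⊤ → I ≤ J → I = J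

/-- The stable finite-type semistar operation `⋆̃` associated to `⋆`:
`E^{⋆̃} = ⋂ { E R_P : P a quasi-⋆_f-maximal ideal }`, where
`x ∈ E R_P ↔ ∃ d ∉ P, d • x ∈ E` (each quasi-⋆_f-maximal ideal is prime); if there
is no quasi-⋆_f-maximal ideal, `E^{⋆̃} = F`. -/
def SemistarOp.tilde (s : SemistarOp R F) (E : Submodule R F) : Submodule R F where
  carrier := {x : F | ∀ P : Ideal R, IsQuasiMax s.ft P → P.IsPrime →
    ∃ d : R, d ∉ P ∧ d • x ∈ E}
  zero_mem' := by
    intro P _ hP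
    exact ⟨1, fun h => hP.ne_top ((Ideal.eq_top_iff_one P).mpr h), by simp⟩
  add_mem' := by
    intro x y hx hy P hPmax hP
    obtain ⟨d₁, hd₁, hdx⟩ := hx P hPmax hP
    obtain ⟨d₂, hd₂, hdy⟩ := hy P hPmax hP
    refine ⟨d₁ * d₂, fun h => (hP.mem_or_mem h).elim hd₁ hd₂, ?_⟩
    have h₁ : (d₁ * d₂) • x ∈ E := by rw [mul_comm, mul_smul]; exact E.smul_mem d₂ hdx
    have h₂ : (d₁ * d₂) • y ∈ E := by rw [mul_smul]; exact E.smul_mem d₁ hdy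
    simpa [smul_add] using E.add_mem h₁ h₂
  smul_mem' := by
    intro r x hx P hPmax hP
    obtain ⟨d, hd, hdx⟩ := hx P hPmax hP
    refine ⟨d, hd, ?_⟩
    rw [smul_smul, mul_comm, ← smul_smul]
    exact E.smul_mem r hdx

/-- The characterization of the quasi-`⋆[n]`-prime ideals of `R[n] = R[X₁,…,Xₙ]` for the
iterated Nagata-type (stable, finite-type) semistar operation `⋆[n]` on `R[n]`:
a nonzero prime `Q` of `R[n]` is quasi-`⋆[n]`-prime iff `Q ∩ R = 0` or
`(Q ∩ R)^{⋆_f} ≠ R^⋆`. -/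
def QuasiPolyPrime (s : SemistarOp R F) (n : ℕ) (Q : Ideal (MvPolynomial (Fin n) R)) : Prop :=
  Q ≠ ⊥ ∧ Q.IsPrime ∧
    (Ideal.comap (algebraMap R (MvPolynomial (Fin n) R)) Q = ⊥ ∨
      s.ft (idealExt (Ideal.comap (algebraMap R (MvPolynomial (Fin n) R)) Q)) ≠
        s.star (idealExt (⊤ : Ideal R)))

/-- The `⋆̃`-dimension of `R`. -/
noncomputable def tildeDim (s : SemistarOp R F) : ℕ∞ := quasiDim (IsQuasiPrime s.tilde)

/-- The `⋆[n]`-dimension of `R[n] = R[X₁,…,Xₙ]`. -/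
noncomputable def polyDim (s : SemistarOp R F) (n : ℕ) : ℕ∞ := quasiDim (QuasiPolyPrime s n)

/-- `R` is a `⋆̃`-S-domain: every height-one quasi-`⋆̃`-prime `P` extends to a height-one
quasi-`⋆[1]`-prime `P[X₁]` of `R[X₁]`. -/
def TildeSDomain (s : SemistarOp R F) : Prop :=
  ∀ P : Ideal R, IsQuasiPrime s.tilde P → idealHeight P = 1 →
    QuasiPolyPrime s 1 (Ideal.map (algebraMap R (MvPolynomial (Fin 1) R)) P) ∧
    idealHeight (Ideal.map (algebraMap R (MvPolynomial (Fin 1) R)) P) = 1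

/-- `R` is a `⋆̃`-strong S-domain: each pair of adjacent quasi-`⋆̃`-primes `P₁ ⊂ P₂`
extends to a pair of adjacent quasi-`⋆[1]`-primes `P₁[X₁] ⊂ P₂[X₁]` of `R[X₁]`. -/
def TildeStrongSDomain (s : SemistarOp R F) : Prop :=
  ExtendsAdjacent (algebraMap R (MvPolynomial (Fin 1) R))
    (IsQuasiPrime s.tilde) (QuasiPolyPrime s 1)

/-- `R[n]` is a `⋆[n]`-strong S-domain: each pair of adjacent quasi-`⋆[n]`-primes
`Q₁ ⊂ Q₂` of `R[n]` extends to a pair of adjacent quasi-`⋆[n+1]`-primes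
`Q₁[X_{n+1}] ⊂ Q₂[X_{n+1}]` of `R[n+1]`. -/
def PolyStrongSDomain (s : SemistarOp R F) (n : ℕ) : Prop :=
  ExtendsAdjacent (MvPolynomial.rename (Fin.castSucc : Fin n → Fin (n + 1))).toRingHom
    (QuasiPolyPrime s n) (QuasiPolyPrime s (n + 1))

/-- `R` is a `⋆̃`-stably strong S-domain: `R[n]` is a `⋆[n]`-strong S-domain for all
`n ≥ 1`. -/
def TildeStablyStrongSDomain (s : SemistarOp R F) : Prop :=
  ∀ n : ℕ, 1 ≤ n → PolyStrongSDomain s n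

/-- `R` is `⋆̃`-catenary. -/
def TildeCatenary (s : SemistarOp R F) : Prop := CatenaryFor (IsQuasiPrime s.tilde)

/-- `R[n]` is `⋆[n]`-catenary. -/
def PolyCatenary (s : SemistarOp R F) (n : ℕ) : Prop := CatenaryFor (QuasiPolyPrime s n)

/-- `R` is `⋆̃`-universally catenarian: `R[n]` is `⋆[n]`-catenary for all `n ≥ 1`. -/
def TildeUnivCatenarian (s : SemistarOp R F) : Prop :=
  ∀ n : ℕ, 1 ≤ n → PolyCatenary s n

/-- `R` is a `⋆̃`-Jaffard domain. -/
def TildeJaffard (s : SemistarOp R F) : Prop :=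
  tildeDim s ≠ ⊤ ∧ ∀ n : ℕ, 1 ≤ n → polyDim s n = tildeDim s + n

/-- `R` is `⋆̃`-Noetherian: ascending chain condition on quasi-`⋆̃`-ideals. -/
def TildeNoetherian (s : SemistarOp R F) : Prop :=
  ∀ f : ℕ → Ideal R, (∀ i, IsQuasiIdeal s.tilde (f i)) → Monotone f →
    ∃ N : ℕ, ∀ m : ℕ, N ≤ m → f m = f N

/-- `R` is a `⋆̃`-quasi-Prüfer domain: every prime `Q` of `R[X]` with `Q ⊆ P[X]` for some
quasi-`⋆̃`-prime `P` of `R` satisfies `Q = (Q ∩ R)[X]`. -/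
def TildeQuasiPrufer (s : SemistarOp R F) : Prop :=
  ∀ Q : Ideal (Polynomial R), Q.IsPrime →
    (∃ P : Ideal R, IsQuasiPrime s.tilde P ∧
      Q ≤ Ideal.map (Polynomial.C : R →+* Polynomial R) P) →
    Q = Ideal.map (Polynomial.C : R →+* Polynomial R)
      (Ideal.comap (Polynomial.C : R →+* Polynomial R) Q)

/-- `R` is a Prüfer `⋆`-multiplication domain: `(I · (R :_F I))^{⋆_f} = R^⋆` for every
nonzero finitely generated ideal `I` of `R`. -/
def IsPStarMD (s : SemistarOp R F) : Prop :=
  ∀ I : Ideal R, I ≠ ⊥ → I.FG →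
    s.ft (idealExt I * ((idealExt (⊤ : Ideal R) : Submodule R F) / idealExt I)) =
      s.star (idealExt (⊤ : Ideal R))

/-- An overring `T` of `R` (with semistar operation `⋆'`) is `(⋆,⋆')`-linked to `R`:
for every nonzero finitely generated ideal `G` of `R`, `G^⋆ = R^⋆` implies
`(GT)^{⋆'} = T^{⋆'}`. -/
def IsLinkedOverring (s : SemistarOp R F) (T : Subalgebra R F) (s' : SemistarOp T F) : Prop :=
  ∀ G : Ideal R, G ≠ ⊥ → G.FG →
    s.star (idealExt G) = s.star (idealExt (⊤ : Ideal R)) →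
      s'.star (idealExt (Ideal.map (algebraMap R T) G)) =
        s'.star (idealExt (⊤ : Ideal T))

/-- `R` is a `⋆̃`-going-down domain: for every overring `T` of `R` (a subring of `F`
containing `R`; note `F` is also the quotient field of `T`) and every semistar operation
`⋆'` on `T`, the extension `R ⊆ T` satisfies `(⋆̃,⋆̃')`-GD. -/
def TildeGoingDown (s : SemistarOp R F) : Prop :=
  ∀ (T : Subalgebra R F) (s' : SemistarOp T F),
    ∀ P₀ P : Ideal R, IsQuasiPrime s.tilde P₀ → IsQuasiPrime s.tilde P → P₀ < P →
      ∀ Q : Ideal T, IsQuasiPrime s'.tilde Q → Ideal.comap (algebraMap R T) Q = P →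
        ∃ Q₀ : Ideal T, IsQuasiPrime s'.tilde Q₀ ∧ Q₀ ≤ Q ∧
          Ideal.comap (algebraMap R T) Q₀ = P₀

end Semistar

universe u

section
variable {R : Type*} [CommRing R] {B : Type*} [CommRing B] [Algebra R B]

/-- A prime of a finite type algebra that is comparable to no other prime of its fibre is
isolated in its fibre. -/
theorem quasiFiniteAt_of_isolated [Algebra.FiniteType R B] (q : Ideal B) [hq : q.IsPrime]
    (hmin : ∀ I : Ideal B, I.IsPrime → I ≤ q → I.under R = q.under R → I = q)
    (hmax : ∀ I : Ideal B, I.IsPrime → q ≤ I → I.under R = q.under R → I = q) :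
    Algebra.QuasiFiniteAt R q := by
  let x : PrimeSpectrum B := ⟨q, hq⟩
  let p := x.comap (algebraMap R B)
  refine Algebra.QuasiFiniteAt.of_isOpen_singleton_fiber (R := R) x ?_
  let e := PrimeSpectrum.preimageHomeomorphFiber R B p
  let e' := PrimeSpectrum.preimageOrderIsoFiber R B p
  have : IsNoetherianRing (p.asIdeal.Fiber B) :=
    Algebra.FiniteType.isNoetherianRing p.asIdeal.ResidueField _
  have : IsJacobsonRing (p.asIdeal.Fiber B) :=
    isJacobsonRing_of_finiteType (A := p.asIdeal.ResidueField)
  suffices IsOpen {e' ⟨x, rfl⟩} by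
    rw [← e.isOpen_image, Set.image_singleton]; exact this
  have key : ∀ y : (PrimeSpectrum.comap (algebraMap R B) ⁻¹' {p}),
      (y ≤ ⟨x, rfl⟩ ∨ ⟨x, rfl⟩ ≤ y) → y = ⟨x, rfl⟩ := by
    rintro ⟨y, hy⟩ h
    have hy' : y.asIdeal.under R = q.under R := congrArg PrimeSpectrum.asIdeal hy
    apply Subtype.ext
    apply PrimeSpectrum.ext
    exact h.elim (fun h ↦ hmin _ y.2 h hy') (fun h ↦ hmax _ y.2 h hy')
  rw [(PrimeSpectrum.isOpen_singleton_tfae_of_isNoetherian_of_isJacobsonRing _).out 0 2 rfl rfl,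
    PrimeSpectrum.isClosed_singleton_iff_isMaximal, ← PrimeSpectrum.isMax_iff]
  constructor
  · intro z hz
    have := key (e'.symm z) (.inr (by rwa [OrderIso.le_symm_apply]))
    rw [← this, e'.apply_symm_apply]
  · intro z w hzw hz
    rw [Set.mem_singleton_iff] at hz
    subst hz
    have := key (e'.symm w) (.inl (by
      rw [OrderIso.symm_apply_le]; exact (PrimeSpectrum.le_iff_specializes _ _).2 hzw))
    rw [Set.mem_singleton_iff, ← this, e'.apply_symm_apply]

theorem isAlgebraic_of_quasiFiniteAt [IsDomain B] [FaithfulSMul R B] [Algebra.FiniteType R B]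
    (q : Ideal B) [q.IsPrime] [Algebra.QuasiFiniteAt R q] : Algebra.IsAlgebraic R B := by
  have : IsDomain R := (FaithfulSMul.algebraMap_injective R B).isDomain
  obtain ⟨r, hrq, hr, H⟩ := Algebra.zariskisMainProperty_iff.1
    (Algebra.ZariskisMainProperty.of_finiteType (R := R) q)
  refine ⟨fun x ↦ ?_⟩
  obtain ⟨m, hm⟩ := H x
  have hr0 : r ^ m ≠ 0 := pow_ne_zero _ (by rintro rfl; exact hrq q.zero_mem)
  exact .of_mul (mem_nonZeroDivisors_of_ne_zero hr0) (hr.isAlgebraic.pow m) hm.isAlgebraic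

end

/-- For any `a` and `b`, one of them divides the other up to a factor outside `p`; for a prime `p`
of an integral domain, this says that the localization at `p` is a valuation ring. -/
def DividesAwayFrom {R : Type*} [CommRing R] (p : Ideal R) : Prop :=
  ∀ a b : R, ∃ u v : R, u ∉ p ∧ (u * a = v * b ∨ u * b = v * a)

section
variable {R : Type*} [CommRing R] {p : Ideal R}

theorem DividesAwayFrom.exists_dvd [p.IsPrime] (h : DividesAwayFrom p) (T : Finset R)
    (hT : T.Nonempty) : ∃ c ∈ T, ∃ u ∉ p, ∀ x ∈ T, ∃ v, u * x = v * c := by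
  classical
  induction hT using Finset.Nonempty.cons_induction with
  | singleton a => exact ⟨a, by simp, 1, Ideal.one_notMem p, fun x hx ↦ ⟨1, by simp_all⟩⟩
  | cons a T ha hT ih =>
    obtain ⟨c, hc, u, hu, H⟩ := ih
    obtain ⟨u', v', hu', h' | h'⟩ := h a c
    · refine ⟨c, by simp [hc], u * u', Ideal.IsPrime.mul_notMem ‹_› hu hu', fun x hx ↦ ?_⟩
      rw [Finset.mem_cons] at hx
      obtain rfl | hx := hx
      · exact ⟨u * v', by rw [mul_assoc, h', mul_assoc]⟩
      · obtain ⟨v, hv⟩ := H x hx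
        exact ⟨u' * v, by rw [mul_right_comm, hv]; ring⟩
    · refine ⟨a, by simp, u * u', Ideal.IsPrime.mul_notMem ‹_› hu hu', fun x hx ↦ ?_⟩
      rw [Finset.mem_cons] at hx
      obtain rfl | hx := hx
      · exact ⟨u * u', rfl⟩
      · obtain ⟨v, hv⟩ := H x hx
        exact ⟨v * v', by rw [mul_right_comm, hv, mul_right_comm, mul_assoc, h', mul_assoc]⟩

theorem DividesAwayFrom.exists_primitive [IsDomain R] [p.IsPrime] (h : DividesAwayFrom p)
    {σ : Type*} {f : MvPolynomial σ R} (hf : f ≠ 0) :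
    ∃ (u c : R) (g : MvPolynomial σ R), u ∉ p ∧ c ≠ 0 ∧
      MvPolynomial.C u * f = MvPolynomial.C c * g ∧ ∃ i, g.coeff i ∉ p := by
  classical
  have hs : (f.support.image f.coeff).Nonempty := by simpa using hf
  obtain ⟨c, hc, u, hu, H⟩ := h.exists_dvd _ hs
  obtain ⟨i, hi, rfl⟩ := Finset.mem_image.1 hc
  have hc0 := MvPolynomial.mem_support_iff.1 hi
  choose! v hv using H
  refine ⟨u, f.coeff i, ∑ m ∈ f.support, MvPolynomial.monomial m (v (f.coeff m)), hu, hc0,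
    ?_, i, ?_⟩
  · conv_lhs => rw [f.as_sum]
    rw [Finset.mul_sum, Finset.mul_sum]
    refine Finset.sum_congr rfl fun m hm ↦ ?_
    rw [MvPolynomial.C_mul_monomial, MvPolynomial.C_mul_monomial,
      hv _ (Finset.mem_image_of_mem _ hm), mul_comm]
  · have : v (f.coeff i) = u := mul_right_cancel₀ hc0 (hv _ hc).symm
    simp [MvPolynomial.coeff_sum, MvPolynomial.coeff_monomial, hc0, this, hu]
end

section
universe v w x
variable {R : Type u} {B C : Type v} {k : Type w}
  [CommRing R] [CommRing B] [CommRing C] [CommRing k]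
  [IsDomain R] [IsDomain B] [IsDomain k]
  [Algebra R B] [Algebra B C] [Algebra R k] [Algebra k C] [Algebra R C]
  [IsScalarTower R B C] [IsScalarTower R k C]

theorem DividesAwayFrom.algebraicIndependent_of_algebraMap [FaithfulSMul R B] {σ : Type x}
    (hp : DividesAwayFrom (RingHom.ker (algebraMap R k))) {y : σ → B}
    (hy : AlgebraicIndependent k (algebraMap B C ∘ y)) : AlgebraicIndependent R y := by
  rw [algebraicIndependent_iff]
  intro f hf
  by_contra hf0
  have : (RingHom.ker (algebraMap R k)).IsPrime := RingHom.ker_isPrime _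
  obtain ⟨u, c, g, hu, hc, h, i, hi⟩ := hp.exists_primitive hf0
  have hg : MvPolynomial.aeval y g = 0 := by
    have := congrArg (MvPolynomial.aeval y) h
    simp only [map_mul, hf, mul_zero, MvPolynomial.aeval_C] at this
    refine (mul_eq_zero.1 this.symm).resolve_left ?_
    rwa [FaithfulSMul.algebraMap_eq_zero_iff]
  have hg' : MvPolynomial.aeval (algebraMap B C ∘ y)
      (MvPolynomial.map (algebraMap R k) g) = 0 := by
    rw [MvPolynomial.aeval_map_algebraMap, MvPolynomial.aeval_algebraMap_apply, hg, map_zero]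
  have := congrArg (MvPolynomial.coeff i) (algebraicIndependent_iff.1 hy _ hg')
  rw [MvPolynomial.coeff_map, MvPolynomial.coeff_zero] at this
  exact hi this

/-- Transcendence degrees are preserved modulo primes `ker (R → k)` and `ker (B → C)`, the latter
being minimal over the extension of the former. -/
theorem DividesAwayFrom.trdeg_eq [IsDomain C] [FaithfulSMul R B] [FaithfulSMul k C]
    [Algebra.FiniteType R B] (hp : DividesAwayFrom (RingHom.ker (algebraMap R k)))
    (hBC : Function.Surjective (algebraMap B C)) (hRk : Function.Surjective (algebraMap R k))
    (hmin : ∀ I : Ideal B, I.IsPrime → I ≤ RingHom.ker (algebraMap B C) →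
      (RingHom.ker (algebraMap R k)).map (algebraMap R B) ≤ I →
      I = RingHom.ker (algebraMap B C)) :
    Algebra.trdeg R B = Algebra.trdeg k C := by
  obtain ⟨s, hs⟩ := exists_isTranscendenceBasis k C
  choose y hy using fun i : s ↦ hBC i.1
  replace hy : algebraMap B C ∘ y = ((↑) : s → C) := funext hy
  have hind : AlgebraicIndependent R y :=
    hp.algebraicIndependent_of_algebraMap (C := C) (by rw [hy]; exact hs.1)
  let q := RingHom.ker (algebraMap B C)
  have hq : q.IsPrime := RingHom.ker_isPrime _
  let S := Algebra.adjoin R (Set.range y)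
  have : Algebra.FiniteType S B := .of_restrictScalars_finiteType R _ B
  have : Algebra.QuasiFiniteAt S q := by
    apply quasiFiniteAt_of_isolated
    · refine fun I hI hIq h ↦ hmin I hI hIq (Ideal.map_le_iff_le_comap.2 fun r hr ↦ ?_)
      have : algebraMap R S r ∈ q.under S := by
        rw [Ideal.mem_comap, ← IsScalarTower.algebraMap_apply, RingHom.mem_ker,
          ← IsScalarTower.algebraMap_apply, IsScalarTower.algebraMap_apply R k C,
          RingHom.mem_ker.1 hr, map_zero]
      rwa [← h, Ideal.mem_comap, ← IsScalarTower.algebraMap_apply] at this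
    · intro I hI hqI h
      refine le_antisymm (fun b hb ↦ ?_) hqI
      by_contra hbq
      have halg := hs.isAlgebraic
      refine Ideal.comap_ne_bot_of_algebraic_mem
        (R := Algebra.adjoin k (Set.range ((↑) : s → C))) (I := I.map (algebraMap B C))
        hbq (Ideal.mem_map_of_mem _ hb) (halg.isAlgebraic _) (le_bot_iff.1 ?_)
      rintro ⟨z, hz⟩ hzI
      rw [Ideal.mem_comap] at hzI
      change z ∈ _ at hzI
      rw [Algebra.adjoin_range_eq_range_aeval] at hz
      obtain ⟨f, rfl⟩ := hz
      obtain ⟨g, rfl⟩ := MvPolynomial.map_surjective _ hRk f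
      have heq : (MvPolynomial.aeval ((↑) : s → C)) (MvPolynomial.map (algebraMap R k) g) =
          algebraMap B C (MvPolynomial.aeval y g) := by
        rw [MvPolynomial.aeval_map_algebraMap, ← hy, MvPolynomial.aeval_algebraMap_apply]
      have hgI : MvPolynomial.aeval y g ∈ I := by
        rw [AlgHom.toRingHom_eq_coe, RingHom.coe_coe, heq, ← Ideal.mem_comap,
          Ideal.comap_map_of_surjective _ hBC] at hzI
        rwa [sup_eq_left.2] at hzI
        exact hqI
      have hgS : MvPolynomial.aeval y g ∈ S := by
        change _ ∈ Algebra.adjoin R (Set.range y)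
        rw [Algebra.adjoin_range_eq_range_aeval]
        exact ⟨g, rfl⟩
      have hgq : (⟨_, hgS⟩ : S) ∈ q.under S := by rw [← h]; exact hgI
      rw [Ideal.mem_bot, Subtype.ext_iff]
      exact heq.trans hgq
  have hyb : IsTranscendenceBasis R y :=
    hind.isTranscendenceBasis_iff_isAlgebraic.2 (isAlgebraic_of_quasiFiniteAt (R := S) q)
  have h := hyb.lift_cardinalMk_eq_trdeg
  rw [Cardinal.lift_id, Cardinal.lift_id] at h
  rw [← h, hs.cardinalMk_eq_trdeg]

end

theorem dividesAwayFrom_X (k : Type*) [CommRing k] [IsDomain k] :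
    DividesAwayFrom (RingHom.ker (Polynomial.constantCoeff (R := k))) := by
  intro g h
  by_cases hg : g = 0
  · subst hg
    exact ⟨1, 0, fun h ↦ one_ne_zero ((map_one _).symm.trans h), by simp⟩
  by_cases hh : h = 0
  · subst hh
    exact ⟨1, 0, fun h ↦ one_ne_zero ((map_one _).symm.trans h), by simp⟩
  obtain ⟨a, ha, ha'⟩ := Polynomial.exists_eq_pow_rootMultiplicity_mul_and_not_dvd g hg 0
  obtain ⟨b, hb, hb'⟩ := Polynomial.exists_eq_pow_rootMultiplicity_mul_and_not_dvd h hh 0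
  rw [Polynomial.C_0, sub_zero] at ha hb ha' hb'
  rw [Polynomial.X_dvd_iff] at ha' hb'
  set m := Polynomial.rootMultiplicity 0 g
  set n := Polynomial.rootMultiplicity 0 h
  rcases le_total m n with hmn | hmn
  · refine ⟨a, b * Polynomial.X ^ (n - m), ha', .inr ?_⟩
    rw [ha, hb, ← Nat.sub_add_cancel hmn, pow_add]
    simp; ring
  · refine ⟨b, a * Polynomial.X ^ (m - n), hb', .inl ?_⟩
    rw [ha, hb, ← Nat.sub_add_cancel hmn, pow_add]
    simp; ring

section
variable {k B C : Type u} [CommRing k] [CommRing B] [CommRing C]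
  [IsDomain k] [IsDomain B] [IsDomain C] [Algebra k B] [Algebra B C] [Algebra k C]
  [IsScalarTower k B C]

/-- The transcendence degree drops by one modulo a height one prime lying over zero. -/
theorem trdeg_eq_add_one_of_height_one [FaithfulSMul k C] [Algebra.FiniteType k B]
    (hBC : Function.Surjective (algebraMap B C)) (hq : RingHom.ker (algebraMap B C) ≠ ⊥)
    (hmin : ∀ I : Ideal B, I.IsPrime → I ≤ RingHom.ker (algebraMap B C) → I ≠ ⊥ →
      I = RingHom.ker (algebraMap B C)) :
    Algebra.trdeg k B = Algebra.trdeg k C + 1 := by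
  obtain ⟨f, hfq, hf0⟩ := Submodule.exists_mem_ne_zero_of_ne_bot hq
  rw [RingHom.mem_ker] at hfq
  have hf (g : Polynomial k) : algebraMap B C (Polynomial.aeval f g) =
      algebraMap k C (Polynomial.constantCoeff g) := by
    rw [← Polynomial.aeval_algebraMap_apply, hfq, Polynomial.aeval_def, Polynomial.eval₂_at_zero]
    rfl
  let : Algebra (Polynomial k) B := (Polynomial.aeval f).toRingHom.toAlgebra
  let : Algebra (Polynomial k) k := (Polynomial.constantCoeff (R := k)).toAlgebra
  let : Algebra (Polynomial k) C := ((algebraMap B C).comp (algebraMap (Polynomial k) B)).toAlgebra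
  have : IsScalarTower (Polynomial k) B C := .of_algebraMap_eq fun r ↦ rfl
  have : IsScalarTower (Polynomial k) k C := .of_algebraMap_eq hf
  have : IsScalarTower k (Polynomial k) B := .of_algebraMap_eq fun r ↦
    (Polynomial.aeval_C f r).symm
  have : Algebra.FiniteType (Polynomial k) B := .of_restrictScalars_finiteType k _ B
  have : FaithfulSMul k B := by
    rw [faithfulSMul_iff_algebraMap_injective]
    refine .of_comp (f := algebraMap B C) ?_
    rw [← RingHom.coe_comp, ← IsScalarTower.algebraMap_eq]
    exact FaithfulSMul.algebraMap_injective k C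
  have : FaithfulSMul (Polynomial k) B := by
    rw [faithfulSMul_iff_algebraMap_injective, injective_iff_map_eq_zero]
    intro g hg
    by_contra hg0
    obtain ⟨a, ha, ha'⟩ := Polynomial.exists_eq_pow_rootMultiplicity_mul_and_not_dvd g hg0 0
    rw [Polynomial.C_0, sub_zero] at ha ha'
    rw [Polynomial.X_dvd_iff] at ha'
    change Polynomial.aeval f g = 0 at hg
    rw [ha, map_mul, map_pow, Polynomial.aeval_X] at hg
    have h0 := hf a
    rw [(mul_eq_zero.1 hg).resolve_left (pow_ne_zero _ hf0), map_zero] at h0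
    exact ha' ((FaithfulSMul.algebraMap_eq_zero_iff k C).1 h0.symm)
  have h1 : Algebra.trdeg (Polynomial k) B = Algebra.trdeg k C := by
    refine DividesAwayFrom.trdeg_eq (dividesAwayFrom_X k) hBC
      (fun r ↦ ⟨Polynomial.C r, Polynomial.coeff_C_zero⟩) fun I hI hIq h ↦ hmin I hI hIq ?_
    rintro rfl
    have hX := h (Ideal.mem_map_of_mem _
      (show Polynomial.X ∈ RingHom.ker _ from Polynomial.coeff_X_zero))
    exact hf0 ((Polynomial.aeval_X (R := k) f).symm.trans hX)
  rw [← trdeg_add_eq k (Polynomial k) (A := B), Polynomial.trdeg_of_isDomain, h1, add_comm]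
end

section
variable {D A : Type u} [CommRing D] [CommRing A] [Algebra D A]

theorem DividesAwayFrom.ker_factor {p p' : Ideal D} (h : p ≤ p') (hp : DividesAwayFrom p') :
    DividesAwayFrom (RingHom.ker (Ideal.Quotient.factor h)) := by
  intro a b
  obtain ⟨a, rfl⟩ := Ideal.Quotient.mk_surjective a
  obtain ⟨b, rfl⟩ := Ideal.Quotient.mk_surjective b
  obtain ⟨u, v, hu, huv⟩ := hp a b
  refine ⟨Ideal.Quotient.mk p u, Ideal.Quotient.mk p v, ?_, ?_⟩
  · rwa [RingHom.mem_ker, Ideal.Quotient.factor_mk, Ideal.Quotient.eq_zero_iff_mem]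
  · exact huv.imp (congrArg (Ideal.Quotient.mk p)) (congrArg (Ideal.Quotient.mk p))

theorem eq_of_isPrime_quotient {Q Q' : Ideal A} (hQ : Q ≤ Q')
    (hadj : ∀ I : Ideal A, I.IsPrime → ¬(Q < I ∧ I < Q')) {I : Ideal (A ⧸ Q)} (hI : I.IsPrime)
    (hIQ : I ≤ RingHom.ker (Ideal.Quotient.factor hQ)) (hI0 : I ≠ ⊥) :
    I = RingHom.ker (Ideal.Quotient.factor hQ) := by
  have hker : (RingHom.ker (Ideal.Quotient.factor hQ)).comap (Ideal.Quotient.mk Q) = Q' := by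
    rw [RingHom.comap_ker, Ideal.Quotient.factor_comp_mk, Ideal.mk_ker]
  apply Ideal.comap_injective_of_surjective _ Ideal.Quotient.mk_surjective
  rw [hker]
  have hle : Q ≤ I.comap (Ideal.Quotient.mk Q) :=
    Ideal.mk_ker.ge.trans (Ideal.comap_mono bot_le)
  have hle' := Ideal.comap_mono (f := Ideal.Quotient.mk Q) hIQ
  rw [hker] at hle'
  by_contra h
  refine hadj _ (Ideal.comap_isPrime (Ideal.Quotient.mk Q) I) ⟨hle.lt_of_ne fun h ↦ hI0 ?_,
    hle'.lt_of_ne h⟩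
  rw [← Ideal.map_comap_of_surjective _ Ideal.Quotient.mk_surjective I, ← h,
    Ideal.map_quotient_self]

theorem trdeg_quotient_eq_add_one [Algebra.FiniteType D A] {p : Ideal D} {Q Q' : Ideal A}
    [p.IsPrime] [Q.IsPrime] [Q'.IsPrime] [Q.LiesOver p] [Q'.LiesOver p] (hQ : Q < Q')
    (hadj : ∀ I : Ideal A, I.IsPrime → ¬(Q < I ∧ I < Q')) :
    Algebra.trdeg (D ⧸ p) (A ⧸ Q) = Algebra.trdeg (D ⧸ p) (A ⧸ Q') + 1 := by
  let := (Ideal.Quotient.factor hQ.le).toAlgebra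
  have : IsScalarTower (D ⧸ p) (A ⧸ Q) (A ⧸ Q') := .of_algebraMap_eq fun r ↦ by
    obtain ⟨r, rfl⟩ := Ideal.Quotient.mk_surjective r
    rfl
  refine trdeg_eq_add_one_of_height_one (Ideal.Quotient.factor_surjective hQ.le)
    (fun h ↦ hQ.not_ge ?_) fun I hI ↦ eq_of_isPrime_quotient hQ.le hadj hI
  rw [← Ideal.mk_ker (I := Q'), ← Ideal.Quotient.factor_comp_mk hQ.le, ← RingHom.comap_ker]
  conv_rhs => rw [← Ideal.mk_ker (I := Q)]
  exact Ideal.comap_mono h.le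

theorem DividesAwayFrom.trdeg_quotient_eq [Algebra.FiniteType D A] {p p' : Ideal D}
    {Q Q' : Ideal A} [p.IsPrime] [p'.IsPrime] [Q.IsPrime] [Q'.IsPrime]
    [Q.LiesOver p] [Q'.LiesOver p'] (hp : DividesAwayFrom p') (hpp : p < p') (hQ : Q < Q')
    (hadj : ∀ I : Ideal A, I.IsPrime → ¬(Q < I ∧ I < Q')) :
    Algebra.trdeg (D ⧸ p) (A ⧸ Q) = Algebra.trdeg (D ⧸ p') (A ⧸ Q') := by
  let := (Ideal.Quotient.factor hQ.le).toAlgebra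
  let := (Ideal.Quotient.factor hpp.le).toAlgebra
  let := ((Ideal.Quotient.factor hQ.le).comp (algebraMap (D ⧸ p) (A ⧸ Q))).toAlgebra
  have : IsScalarTower (D ⧸ p) (A ⧸ Q) (A ⧸ Q') := .of_algebraMap_eq fun r ↦ rfl
  have : IsScalarTower (D ⧸ p) (D ⧸ p') (A ⧸ Q') := .of_algebraMap_eq fun r ↦ by
    obtain ⟨r, rfl⟩ := Ideal.Quotient.mk_surjective r
    rfl
  refine (hp.ker_factor hpp.le).trdeg_eq (Ideal.Quotient.factor_surjective hQ.le)
    (Ideal.Quotient.factor_surjective hpp.le) fun I hI hIQ h ↦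
      eq_of_isPrime_quotient hQ.le hadj hI hIQ ?_
  rintro rfl
  obtain ⟨x, hx, hx'⟩ := SetLike.exists_of_lt hpp
  have : algebraMap (D ⧸ p) (A ⧸ Q) (Ideal.Quotient.mk p x) = 0 :=
    h (Ideal.mem_map_of_mem _ (Ideal.Quotient.eq_zero_iff_mem.2 hx))
  rw [FaithfulSMul.algebraMap_eq_zero_iff, Ideal.Quotient.eq_zero_iff_mem] at this
  exact hx' this

variable {p p' : Ideal D}

theorem DividesAwayFrom.exists_mul_eq_mul [p'.IsPrime] (hp : DividesAwayFrom p') (p₁ : Ideal D)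
    [p₁.IsPrime] (h₁ : p₁ ≤ p') {d : D} (hd : d ∉ p₁) {y : A}
    (hy : y ∈ p₁.map (algebraMap D A)) :
    ∃ u ∉ p', ∃ z ∈ p₁.map (algebraMap D A), algebraMap D A u * y = algebraMap D A d * z := by
  induction hy using Submodule.span_induction with
  | mem y hy =>
    obtain ⟨w, hw, rfl⟩ := hy
    obtain ⟨u, c, hu, h | h⟩ := hp w d
    · refine ⟨u, hu, algebraMap D A c, Ideal.mem_map_of_mem _ ?_, ?_⟩
      · have : c * d ∈ p₁ := h ▸ p₁.mul_mem_left u hw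
        exact (‹p₁.IsPrime›.mem_or_mem this).resolve_right hd
      · rw [← map_mul, h, mul_comm, map_mul]
    · have : u * d ∈ p₁ := h ▸ p₁.mul_mem_left c hw
      exact absurd this (‹p₁.IsPrime›.mul_notMem (fun h ↦ hu (h₁ h)) hd)
  | zero => exact ⟨1, Ideal.one_notMem _, 0, zero_mem _, by simp⟩
  | add y y' _ _ h h' =>
    obtain ⟨u, hu, z, hz, h⟩ := h
    obtain ⟨u', hu', z', hz', h'⟩ := h'
    refine ⟨u * u', Ideal.IsPrime.mul_notMem ‹_› hu hu',
      algebraMap D A u' * z + algebraMap D A u * z',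
      add_mem (Ideal.mul_mem_left _ _ hz) (Ideal.mul_mem_left _ _ hz'), ?_⟩
    rw [map_mul]
    linear_combination algebraMap D A u' * h + algebraMap D A u * h'
  | smul a y _ h =>
    obtain ⟨u, hu, z, hz, h⟩ := h
    refine ⟨u, hu, a * z, Ideal.mul_mem_left _ _ hz, ?_⟩
    rw [smul_eq_mul]
    linear_combination a * h

/-- Going down relative to `Q`: a prime between `Q.under D` and `Q'.under D` lifts to a prime
between `Q` and `Q'`. -/
theorem DividesAwayFrom.exists_isPrime_under_eq [p'.IsPrime] (hp : DividesAwayFrom p')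
    {p₁ : Ideal D} (h₁ : p₁ ≤ p') [p₁.IsPrime] {Q Q' : Ideal A} [Q.IsPrime] [Q'.IsPrime]
    (hQ : Q ≤ Q') [Q'.LiesOver p'] (hQp : Q.under D ≤ p₁) :
    ∃ Q₁ : Ideal A, Q₁.IsPrime ∧ Q ≤ Q₁ ∧ Q₁ ≤ Q' ∧ Q₁.under D = p₁ := by
  let S : Submonoid A := Q'.primeCompl ⊔ (p₁.primeCompl).map (algebraMap D A)
  have hdis : Disjoint ((Q ⊔ p₁.map (algebraMap D A) : Ideal A) : Set A) (S : Set A) := by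
    rw [Set.disjoint_left]
    intro x hx hxS
    obtain ⟨a, ha, _, ⟨d, hd, rfl⟩, rfl⟩ := Submonoid.mem_sup.1 hxS
    obtain ⟨y, hy, w, hw, hyw⟩ := Submodule.mem_sup.1 hx
    obtain ⟨u, hu, z, hz, huz⟩ := hp.exists_mul_eq_mul p₁ h₁ (d := d) hd hw
    have hdQ : algebraMap D A d ∉ Q := fun h ↦ hd (hQp h)
    have h2 : algebraMap D A d * (algebraMap D A u * a - z) ∈ Q := by
      have : algebraMap D A d * (algebraMap D A u * a - z) = algebraMap D A u * y := by
        change y + w = a * algebraMap D A d at hyw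
        linear_combination huz - algebraMap D A u * hyw
      rw [this]
      exact Q.mul_mem_left _ hy
    have h3 := hQ ((‹Q.IsPrime›.mem_or_mem h2).resolve_left hdQ)
    have hle : p₁.map (algebraMap D A) ≤ Q' := by
      rw [Ideal.map_le_iff_le_comap]
      exact h₁.trans (Ideal.over_def Q' p').le
    have h4 : algebraMap D A u * a ∈ Q' := by simpa using Q'.add_mem h3 (hle hz)
    refine (‹Q'.IsPrime›.mem_or_mem h4).elim (fun h ↦ hu ?_) ha
    rw [Ideal.over_def Q' p']
    exact h
  obtain ⟨Q₁, hQ₁, hle, hdis⟩ := Ideal.exists_le_prime_disjoint _ _ hdis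
  refine ⟨Q₁, hQ₁, le_sup_left.trans hle, fun x hx ↦ ?_, le_antisymm (fun x hx ↦ ?_) ?_⟩
  · by_contra hxQ
    exact Set.disjoint_left.1 hdis hx (Submonoid.mem_sup_left (show x ∈ Q'.primeCompl from hxQ))
  · by_contra hxp
    exact Set.disjoint_left.1 hdis hx (Submonoid.mem_sup_right
      (Submonoid.mem_map_of_mem (algebraMap D A) (show x ∈ p₁.primeCompl from hxp)))
  · exact Ideal.map_le_iff_le_comap.1 (le_sup_right.trans hle)

theorem DividesAwayFrom.le_total (hp : DividesAwayFrom p) {p₁ p₂ : Ideal D}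
    [p₁.IsPrime] [p₂.IsPrime] (h₁ : p₁ ≤ p) (h₂ : p₂ ≤ p) : p₁ ≤ p₂ ∨ p₂ ≤ p₁ := by
  by_contra! h
  obtain ⟨a, ha, ha'⟩ := SetLike.not_le_iff_exists.1 h.1
  obtain ⟨b, hb, hb'⟩ := SetLike.not_le_iff_exists.1 h.2
  obtain ⟨u, v, hu, h | h⟩ := hp a b
  · exact ‹p₂.IsPrime›.mul_notMem (fun h ↦ hu (h₂ h)) ha' (h ▸ p₂.mul_mem_left v hb)
  · exact ‹p₁.IsPrime›.mul_notMem (fun h ↦ hu (h₁ h)) hb' (h ▸ p₁.mul_mem_left v ha)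
end

section
variable {D A : Type u} [CommRing D] [CommRing A] [Algebra D A]

theorem DividesAwayFrom.height_eq_add_one {p p' : Ideal D} [hp : p.IsPrime] [hp' : p'.IsPrime]
    (h : DividesAwayFrom p') (hpp : p < p') (hadj : ∀ I : Ideal D, I.IsPrime → ¬(p < I ∧ I < p')) :
    p'.height = p.height + 1 := by
  refine le_antisymm ?_ (Ideal.height_add_one_le_of_lt_of_isPrime hpp)
  rw [PrimeSpectrum.height_eq_orderHeight ⟨p', hp'⟩, Order.height_eq_iSup_lt_height]
  refine iSup₂_le fun y hy ↦ ?_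
  gcongr
  rw [← PrimeSpectrum.height_eq_orderHeight]
  apply Ideal.height_mono
  have hy' : y.asIdeal < p' := hy
  refine (h.le_total hy'.le hpp.le).elim id fun h ↦ ?_
  by_contra h'
  exact hadj y.asIdeal y.2 ⟨h.lt_of_not_ge h', hy'⟩

theorem height_le_idealHeight (p : Ideal D) [hp : p.IsPrime] : p.height ≤ idealHeight p := by
  rw [PrimeSpectrum.height_eq_orderHeight ⟨p, hp⟩, Order.height_eq_iSup_last_eq]
  refine iSup₂_le fun l hl ↦ ?_
  exact le_iSup₂_of_le l.length ⟨fun i ↦ (l i).asIdeal, fun i j h ↦ l.strictMono h,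
    fun i ↦ (l i).2, congrArg PrimeSpectrum.asIdeal hl⟩ le_rfl

/-- The transcendence degree of `A ⧸ Q` over `D ⧸ (Q ∩ D)`, as a natural number. -/
noncomputable def residualTrdeg (D : Type u) {A : Type u} [CommRing D] [CommRing A] [Algebra D A]
    (Q : Ideal A) : ℕ :=
  (Algebra.trdeg (D ⧸ Q.under D) (A ⧸ Q)).toNat

theorem residualTrdeg_eq (Q : Ideal A) (p : Ideal D) [h : Q.LiesOver p] :
    residualTrdeg D Q = (Algebra.trdeg (D ⧸ p) (A ⧸ Q)).toNat := by
  obtain rfl := h.over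
  rfl

/-- The dimension formula for an adjacent pair of primes. -/
theorem height_add_residualTrdeg [Algebra.FiniteType D A] {Q Q' : Ideal A} [Q.IsPrime] [Q'.IsPrime]
    (hQ : Q < Q') (hadj : ∀ I : Ideal A, I.IsPrime → ¬(Q < I ∧ I < Q'))
    (hp : DividesAwayFrom (Q'.under D)) :
    (Q'.under D).height + residualTrdeg D Q =
      (Q.under D).height + residualTrdeg D Q' + 1 := by
  obtain h | h := (Ideal.comap_mono hQ.le : Q.under D ≤ Q'.under D).eq_or_lt
  · have : Q.LiesOver (Q'.under D) := ⟨h.symm⟩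
    rw [residualTrdeg_eq Q (Q'.under D), trdeg_quotient_eq_add_one hQ hadj, Cardinal.toNat_add]
    · simp [residualTrdeg, h, add_assoc]
    · exact trdeg_lt_aleph0_of_finiteType
    · exact Cardinal.one_lt_aleph0
  · rw [hp.height_eq_add_one h, residualTrdeg, residualTrdeg,
      hp.trdeg_quotient_eq h hQ hadj, add_right_comm]
    rintro I hI ⟨h1, h2⟩
    obtain ⟨Q₁, hQ₁, hle, hle', rfl⟩ := hp.exists_isPrime_under_eq h2.le hQ.le h1.le
    refine hadj Q₁ hQ₁ ⟨hle.lt_of_ne ?_, hle'.lt_of_ne ?_⟩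
    · rintro rfl; exact h1.ne rfl
    · rintro rfl; exact h2.ne rfl

theorem CatenaryFor.of_dimensionFormula {Φ : Ideal A → Prop} (H : Ideal A → ℕ∞) (t : Ideal A → ℕ)
    (hH : ∀ Q, Φ Q → H Q ≠ ⊤)
    (h : ∀ Q Q', Φ Q → Φ Q' → AdjacentFor Φ Q Q' → H Q' + t Q = H Q + t Q' + 1) :
    CatenaryFor Φ := by
  have key (P Q : Ideal A) (m : ℕ) (hm : SaturatedChainFor Φ P Q m) :
      H Q + t P = H P + t Q + m := by
    obtain ⟨c, -, rfl, rfl, hc, hadj⟩ := hm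
    suffices ∀ i : Fin (m + 1), H (c i) + t (c 0) = H (c 0) + t (c i) + (i : ℕ) by
      simpa using this (Fin.last m)
    intro i
    induction i using Fin.induction with
    | zero => simp
    | succ i ih =>
      have h1 := h _ _ (hc _) (hc _) (hadj i)
      have e0 := hH _ (hc 0)
      have e1 := hH _ (hc i.castSucc)
      have e2 := hH _ (hc i.succ)
      lift H (c 0) to ℕ using e0 with a
      lift H (c i.castSucc) to ℕ using e1 with b
      lift H (c i.succ) to ℕ using e2 with d
      rw [Fin.val_castSucc] at ih
      rw [Fin.val_succ]
      norm_cast at *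
      omega
  intro P Q hP hQ _ m₁ m₂ h₁ h₂
  have := (key P Q m₁ h₁).symm.trans (key P Q m₂ h₂)
  have e := hH P hP
  lift H P to ℕ using e with a
  norm_cast at this
  omega
end

section
variable {D F : Type*} [CommRing D] [Field F] [Algebra D F]

theorem algebraMap_mem_idealExt {I : Ideal D} {a : D} (h : a ∈ I) :
    algebraMap D F a ∈ (idealExt I : Submodule D F) :=
  ⟨a, h, rfl⟩

theorem idealExt_mono {I J : Ideal D} (h : I ≤ J) : (idealExt I : Submodule D F) ≤ idealExt J :=
  Submodule.map_mono h

theorem idealExt_ne_bot [FaithfulSMul D F] {I : Ideal D} (h : I ≠ ⊥) :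
    (idealExt I : Submodule D F) ≠ ⊥ := by
  obtain ⟨a, ha, ha0⟩ := Submodule.exists_mem_ne_zero_of_ne_bot h
  exact (Submodule.ne_bot_iff _).2 ⟨_, algebraMap_mem_idealExt ha, by simpa using ha0⟩

theorem one_mem_idealExt_top : (1 : F) ∈ (idealExt ⊤ : Submodule D F) :=
  ⟨1, trivial, map_one (algebraMap D F)⟩

theorem idealExt_top_le {E : Submodule D F} (h : 1 ∈ E) : idealExt ⊤ ≤ E := by
  rintro _ ⟨a, -, rfl⟩
  rw [Algebra.linearMap_apply, Algebra.algebraMap_eq_smul_one]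
  exact E.smul_mem a h

namespace SemistarOp
variable (s : SemistarOp D F)

theorem star_ne_bot {E : Submodule D F} (hE : E ≠ ⊥) : s.star E ≠ ⊥ :=
  ne_bot_of_le_ne_bot hE (s.le_star E hE)

theorem mem_ft {E : Submodule D F} (hE : E ≠ ⊥) {x : F} :
    x ∈ s.ft E ↔ ∃ G : Submodule D F, G.FG ∧ G ≠ ⊥ ∧ G ≤ E ∧ x ∈ s.star G := by
  obtain ⟨e, he, he0⟩ := Submodule.exists_mem_ne_zero_of_ne_bot hE
  have : Nonempty {G : Submodule D F // G.FG ∧ G ≠ ⊥ ∧ G ≤ E} :=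
    ⟨⟨D ∙ e, Submodule.fg_span_singleton e, by simpa using he0, by simpa using he⟩⟩
  have hdir : Directed (· ≤ ·)
      fun G : {G : Submodule D F // G.FG ∧ G ≠ ⊥ ∧ G ≤ E} ↦ s.star G.1 := by
    rintro ⟨G, hG, hG0, hGE⟩ ⟨H, hH, hH0, hHE⟩
    have h0 : G ⊔ H ≠ ⊥ := ne_bot_of_le_ne_bot hG0 le_sup_left
    exact ⟨⟨G ⊔ H, hG.sup hH, h0, sup_le hGE hHE⟩, s.star_mono _ _ hG0 h0 le_sup_left,
      s.star_mono _ _ hH0 h0 le_sup_right⟩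
  rw [ft, iSup_subtype', Submodule.mem_iSup_of_directed _ hdir]
  simp [and_assoc]

theorem le_ft (E : Submodule D F) : E ≤ s.ft E := by
  intro e he
  obtain rfl | he0 := eq_or_ne e 0
  · exact zero_mem _
  · have h0 : (D ∙ e) ≠ ⊥ := by simpa using he0
    exact (s.mem_ft ((Submodule.ne_bot_iff _).2 ⟨e, he, he0⟩)).2 ⟨D ∙ e,
      Submodule.fg_span_singleton e, h0, by simpa using he,
      s.le_star _ h0 (Submodule.mem_span_singleton_self e)⟩

theorem ft_mono {E E' : Submodule D F} (h : E ≤ E') : s.ft E ≤ s.ft E' :=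
  iSup_le fun G ↦ iSup_le fun hG ↦ le_iSup₂_of_le G ⟨hG.1, hG.2.1, hG.2.2.trans h⟩ le_rfl

theorem ft_le_star {E : Submodule D F} (hE : E ≠ ⊥) : s.ft E ≤ s.star E :=
  iSup₂_le fun _ hG ↦ s.star_mono _ _ hG.2.1 hE hG.2.2

theorem exists_fg_le_star {E : Submodule D F} (hE : E ≠ ⊥) {G : Submodule D F} (hG : G.FG)
    (hGE : G ≤ s.ft E) : ∃ H : Submodule D F, H.FG ∧ H ≠ ⊥ ∧ H ≤ E ∧ G ≤ s.star H := by
  induction G, hG using Submodule.fg_induction with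
  | singleton x =>
    simpa [Submodule.span_singleton_le_iff_mem] using (s.mem_ft hE).1
      (hGE (Submodule.mem_span_singleton_self x))
  | sup G₁ G₂ _ _ h₁ h₂ =>
    obtain ⟨H₁, hf₁, h0₁, hE₁, h₁⟩ := h₁ (le_sup_left.trans hGE)
    obtain ⟨H₂, hf₂, h0₂, hE₂, h₂⟩ := h₂ (le_sup_right.trans hGE)
    have h0 : H₁ ⊔ H₂ ≠ ⊥ := ne_bot_of_le_ne_bot h0₁ le_sup_left
    exact ⟨H₁ ⊔ H₂, hf₁.sup hf₂, h0, sup_le hE₁ hE₂,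
      sup_le (h₁.trans (s.star_mono _ _ h0₁ h0 le_sup_left))
        (h₂.trans (s.star_mono _ _ h0₂ h0 le_sup_right))⟩

theorem ft_ft {E : Submodule D F} (hE : E ≠ ⊥) : s.ft (s.ft E) = s.ft E := by
  refine le_antisymm (iSup₂_le fun G hG ↦ ?_) (s.le_ft _)
  obtain ⟨H, hH, h0, hHE, hGH⟩ := s.exists_fg_le_star hE hG.1 hG.2.2
  refine (s.star_mono _ _ hG.2.1 (s.star_ne_bot h0) hGH).trans ?_
  rw [s.star_idem _ h0]
  exact le_iSup₂_of_le H ⟨hH, h0, hHE⟩ le_rfl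

theorem smul_mem_ft {E : Submodule D F} (hE : E ≠ ⊥) {a x : F} (ha : a ≠ 0) (hx : x ∈ s.ft E) :
    a * x ∈ s.ft (a • E) := by
  obtain ⟨G, hG, h0, hGE, hxG⟩ := (s.mem_ft hE).1 hx
  have hle : a • G ≤ a • E := Submodule.map_mono hGE
  have h0' : a • G ≠ ⊥ := by
    obtain ⟨g, hg, hg0⟩ := Submodule.exists_mem_ne_zero_of_ne_bot h0
    exact (Submodule.ne_bot_iff _).2 ⟨a • g, Submodule.smul_mem_pointwise_smul _ _ _ hg,
      by simpa using ⟨ha, hg0⟩⟩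
  refine (s.mem_ft (ne_bot_of_le_ne_bot h0' hle)).2 ⟨a • G, hG.map _, h0', hle, ?_⟩
  rw [s.star_smul a ha G h0]
  exact Submodule.smul_mem_pointwise_smul _ _ _ hxG

theorem ft_ne_star_iff [FaithfulSMul D F] [Nontrivial D] {I : Ideal D} (hI : I ≠ ⊥) :
    s.ft (idealExt I) ≠ s.star (idealExt ⊤) ↔ 1 ∉ s.ft (idealExt I) := by
  rw [not_iff_not]
  have hI' : (idealExt I : Submodule D F) ≠ ⊥ := idealExt_ne_bot hI
  have ht : (idealExt ⊤ : Submodule D F) ≠ ⊥ := idealExt_ne_bot top_ne_bot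
  refine ⟨fun h ↦ h ▸ s.le_star _ ht one_mem_idealExt_top, fun h ↦ le_antisymm
    ((s.ft_le_star hI').trans (s.star_mono _ _ hI' ht (idealExt_mono le_top))) ?_⟩
  obtain ⟨G, hG, h0, hGE, h1⟩ := (s.mem_ft hI').1 h
  refine (s.star_mono _ _ ht (s.star_ne_bot h0) (idealExt_top_le h1)).trans ?_
  rw [s.star_idem _ h0]
  exact le_iSup₂_of_le G ⟨hG, h0, hGE⟩ le_rfl

theorem one_notMem_ft_idealCon [FaithfulSMul D F] {I : Ideal D} (hI : I ≠ ⊥)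
    (h : 1 ∉ s.ft (idealExt I)) :
    1 ∉ s.ft (idealExt (idealCon (s.ft (idealExt I)))) := fun h1 ↦ h <| by
  rw [← s.ft_ft (idealExt_ne_bot hI)]
  exact s.ft_mono (Submodule.map_comap_le _ _) h1

theorem le_idealCon_ft (I : Ideal D) : I ≤ idealCon (s.ft (idealExt I : Submodule D F)) :=
  fun _ ha ↦ s.le_ft _ (algebraMap_mem_idealExt ha)

theorem exists_isQuasiMax [FaithfulSMul D F] [IsDomain D] {I : Ideal D} (hI : I ≠ ⊥)
    (h : 1 ∉ s.ft (idealExt I)) :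
    ∃ M : Ideal D, IsQuasiMax s.ft M ∧ M.IsPrime ∧ I ≤ M := by
  have hub : ∀ c ⊆ {J : Ideal D | I ≤ J ∧ (1 : F) ∉ s.ft (idealExt J)}, IsChain (· ≤ ·) c →
      ∀ J ∈ c, ∃ K ∈ {J : Ideal D | I ≤ J ∧ (1 : F) ∉ s.ft (idealExt J)}, ∀ L ∈ c, L ≤ K := by
    intro c hc hchain J hJ
    refine ⟨sSup c, ⟨(hc hJ).1.trans (le_sSup hJ), fun h1 ↦ ?_⟩, fun _ ↦ le_sSup⟩
    have hJ0 : J ≠ ⊥ := ne_bot_of_le_ne_bot hI (hc hJ).1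
    obtain ⟨G, hG, h0, hGE, h1⟩ :=
      (s.mem_ft (idealExt_ne_bot (ne_bot_of_le_ne_bot hJ0 (le_sSup hJ)))).1 h1
    have hE : (idealExt (sSup c) : Submodule D F) = ⨆ K : c, idealExt K.1 := by
      rw [idealExt, sSup_eq_iSup', Submodule.map_iSup]
      rfl
    have : Nonempty c := ⟨⟨J, hJ⟩⟩
    obtain ⟨K, hK⟩ : ∃ K : c, G ≤ idealExt K.1 := by
      rw [hE] at hGE
      have hdir : Directed (· ≤ ·) fun K : c ↦ (idealExt K.1 : Submodule D F) :=
        hchain.directed.mono_comp _ fun _ _ ↦ idealExt_mono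
      obtain ⟨_, ⟨K, rfl⟩, hK⟩ :=
        (CompleteLattice.isCompactElement_iff_le_of_directed_sSup_le _ _).1
        ((Submodule.fg_iff_compact G).1 hG) _ (Set.range_nonempty _) hdir.directedOn_range hGE
      exact ⟨K, hK⟩
    refine (hc K.2).2 ((s.mem_ft ?_).2 ⟨G, hG, h0, hK, h1⟩)
    exact idealExt_ne_bot (ne_bot_of_le_ne_bot hI (hc K.2).1)
  obtain ⟨M, hIM, hM⟩ := zorn_le_nonempty₀ _ hub I ⟨le_rfl, h⟩
  have hM0 : M ≠ ⊥ := ne_bot_of_le_ne_bot hI hIM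
  have hmem (J : Ideal D) (hJ : M ≤ J) (h1 : (1 : F) ∉ s.ft (idealExt J)) : J ≤ M :=
    hM.2 ⟨hIM.trans hJ, h1⟩ hJ
  have h1 := hM.1.2
  have hcon : idealCon (s.ft (idealExt M)) = M :=
    le_antisymm (hmem _ (s.le_idealCon_ft M) (s.one_notMem_ft_idealCon hM0 h1)) (s.le_idealCon_ft M)
  have htop : M ≠ ⊤ := by
    rintro rfl
    exact h1 (s.le_ft _ one_mem_idealExt_top)
  refine ⟨M, ⟨⟨hM0, hcon⟩, htop, fun J hJ hJt hMJ ↦ le_antisymm hMJ (hmem J hMJ fun h1 ↦ hJt ?_)⟩,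
    ⟨htop, fun {a b} hab ↦ ?_⟩, hIM⟩
  · rw [Ideal.eq_top_iff_one, ← hJ.2]
    exact (map_one (algebraMap D F)).symm.subst (motive := (· ∈ s.ft (idealExt J))) h1
  · by_contra! hab'
    obtain ⟨ha, hb⟩ := hab'
    have hb0 : algebraMap D F b ≠ 0 := by
      rw [Ne, FaithfulSMul.algebraMap_eq_zero_iff]
      rintro rfl
      exact hb M.zero_mem
    have h2 : (1 : F) ∈ s.ft (idealExt (M ⊔ Ideal.span {a})) := by
      by_contra h2
      exact ha (hmem _ le_sup_left h2 (Ideal.mem_sup_right (Ideal.mem_span_singleton_self a)))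
    have h3 := s.smul_mem_ft (idealExt_ne_bot (ne_bot_of_le_ne_bot hM0 le_sup_left)) hb0 h2
    refine hb (hcon ▸ ?_)
    rw [mul_one] at h3
    refine s.ft_mono ?_ h3
    rintro _ ⟨_, ⟨y, hy, rfl⟩, rfl⟩
    refine ⟨b * y, ?_, by simp⟩
    have hle : M ⊔ Ideal.span {a} ≤ Submodule.comap (LinearMap.mulLeft D b) M := by
      refine sup_le (fun x hx ↦ M.mul_mem_left b hx) ?_
      rw [Ideal.span_singleton_le_iff_mem]
      change b * a ∈ M
      rwa [mul_comm]
    exact hle hy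

variable {s}

theorem height_ne_top_of_one_notMem [FaithfulSMul D F] [IsDomain D]
    (hLFD : ∀ P : Ideal D, IsQuasiPrime s.tilde P → idealHeight P ≠ ⊤) {p : Ideal D} [p.IsPrime]
    (hp0 : p ≠ ⊥) (h : 1 ∉ s.ft (idealExt p)) : p.height ≠ ⊤ := by
  refine ne_top_of_le_ne_top (hLFD p ⟨‹_›, hp0, le_antisymm (fun x hx ↦ ?_) fun x hx P _ hP ↦
    ⟨1, P.one_notMem, ?_⟩⟩) (height_le_idealHeight p)
  · obtain ⟨M, hM, hMp, hpM⟩ := s.exists_isQuasiMax hp0 h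
    obtain ⟨d, hd, y, hy, hyx⟩ := hx M hM hMp
    rw [Algebra.linearMap_apply, Algebra.linearMap_apply, Algebra.smul_def, ← map_mul] at hyx
    rw [FaithfulSMul.algebraMap_injective D F hyx] at hy
    exact (‹p.IsPrime›.mem_or_mem hy).resolve_left fun h ↦ hd (hpM h)
  · rw [one_smul]
    exact algebraMap_mem_idealExt hx

end SemistarOp

theorem IsPStarMD.dividesAwayFrom [Nontrivial D] [FaithfulSMul D F] {s : SemistarOp D F}
    (hP : IsPStarMD s) {p : Ideal D} [p.IsPrime] (h1 : 1 ∉ s.ft (idealExt p)) :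
    DividesAwayFrom p := by
  intro a b
  obtain rfl | ha := eq_or_ne a 0
  · exact ⟨1, 0, p.one_notMem, by simp⟩
  have hI0 : Ideal.span {a, b} ≠ ⊥ := by
    rw [Ne, Ideal.span_eq_bot]
    exact fun h ↦ ha (h a (by simp))
  have hprod := hP _ hI0 (Submodule.fg_span (by simp))
  have key : ¬ (idealExt (Ideal.span {a, b}) *
      (idealExt ⊤ / idealExt (Ideal.span {a, b})) : Submodule D F) ≤ idealExt p := fun hle ↦
    h1 (s.ft_mono hle (hprod ▸ s.le_star _ (idealExt_ne_bot top_ne_bot) one_mem_idealExt_top))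
  rw [Submodule.mul_le] at key
  push Not at key
  obtain ⟨_, ⟨m, hm, rfl⟩, x, hx, hmx⟩ := key
  rw [Submodule.mem_div_iff_forall_mul_mem] at hx
  obtain ⟨u, -, hu⟩ := hx _ (algebraMap_mem_idealExt (Ideal.subset_span (Set.mem_insert a {b})))
  obtain ⟨v, -, hv⟩ := hx _
    (algebraMap_mem_idealExt (Ideal.subset_span (Set.mem_insert_of_mem a rfl)))
  rw [Algebra.linearMap_apply] at hu hv
  obtain ⟨c, d, rfl⟩ := Ideal.mem_span_pair.1 hm
  have huv : v * a = u * b := FaithfulSMul.algebraMap_injective D F <| by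
    rw [map_mul, map_mul, hu, hv]; ring
  by_cases hup : u ∈ p
  · refine ⟨v, u, fun hvp ↦ hmx ⟨c * u + d * v, add_mem (p.mul_mem_left _ hup)
      (p.mul_mem_left _ hvp), ?_⟩, .inl huv⟩
    simp only [Algebra.linearMap_apply, map_add, map_mul, hu, hv]; ring
  · exact ⟨u, v, hup, .inr huv.symm⟩

theorem dividesAwayFrom_bot [Nontrivial D] : DividesAwayFrom (⊥ : Ideal D) := by
  intro a b
  obtain rfl | ha := eq_or_ne a 0
  · exact ⟨1, 0, one_ne_zero, by simp⟩
  · exact ⟨a, b, ha, .inr (mul_comm _ _)⟩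
end

/-- Every `⋆̃`-locally finite dimensional P`⋆`MD is `⋆̃`-universally
catenarian. -/
theorem pStarMD_isTildeUnivCatenarian (D : Type*) [CommRing D] [IsDomain D]
    (s : SemistarOp D (FractionRing D)) (hP : IsPStarMD s)
    (hLFD : ∀ P : Ideal D, IsQuasiPrime s.tilde P → idealHeight P ≠ ⊤) :
    TildeUnivCatenarian s := by
  intro n _
  have hcases (Q) (hQ : QuasiPolyPrime s n Q) : Q.under D = ⊥ ∨ Q.under D ≠ ⊥ ∧
      1 ∉ s.ft (idealExt (Q.under D)) := by
    refine or_iff_not_imp_left.2 fun h ↦ ⟨h, (s.ft_ne_star_iff h).1 (hQ.2.2.resolve_left h)⟩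
  refine .of_dimensionFormula (fun Q ↦ (Q.under D).height) (residualTrdeg D) (fun Q hQ ↦ ?_)
    fun Q Q' hQ hQ' hadj ↦ ?_
  · have := hQ.2.1
    obtain h | ⟨h0, h1⟩ := hcases Q hQ
    · simp [h]
    · exact SemistarOp.height_ne_top_of_one_notMem hLFD h0 h1
  · have := hQ.2.1
    have := hQ'.2.1
    refine height_add_residualTrdeg hadj.1 (fun I hI hlt ↦ hadj.2 I ⟨?_, hI, ?_⟩ hlt) ?_
    · exact ne_bot_of_gt hlt.1
    · have hle : I.under D ≤ Q'.under D := Ideal.comap_mono hlt.2.le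
      obtain h | ⟨h0, h1⟩ := hcases Q' hQ'
      · exact .inl (le_bot_iff.1 (h ▸ hle))
      · refine or_iff_not_imp_left.2 fun hI0 ↦ (s.ft_ne_star_iff hI0).2 fun h ↦ h1 ?_
        exact s.ft_mono (idealExt_mono hle) h
    · obtain h | ⟨h0, h1⟩ := hcases Q' hQ'
      · rw [h]
        exact dividesAwayFrom_bot
      · exact hP.dividesAwayFrom h1
end

section
/- Let ⋆ be a semistar operation on an integral domain D. If the polynomial ring D[X₁] is ⋆[1]-catenary, then D is a ⋆̃-strong S-domain. -/
/- ## Preliminaries: general ideal-chain notions in a commutative ring -/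

open Pointwise

section QuasiPrimes

variable {R F : Type*} [CommRing R] [Field F] [Algebra R F]

theorem algebraMap_mem_idealExt_s12 (hinj : Function.Injective (algebraMap R F)) {I : Ideal R} {r : R} :
    algebraMap R F r ∈ (idealExt I : Submodule R F) ↔ r ∈ I :=
  ⟨fun ⟨_, hx, hxr⟩ => hinj hxr ▸ hx, fun hr => ⟨r, hr, rfl⟩⟩

theorem SemistarOp.ft_mono_s12 (s : SemistarOp R F) {E G : Submodule R F} (hEG : E ≤ G) :
    s.ft E ≤ s.ft G :=
  iSup_mono fun _ => iSup_mono' fun hK => ⟨⟨hK.1, hK.2.1, hK.2.2.trans hEG⟩, le_rfl⟩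

/-- The quasi-`⋆̃`-primes are the nonzero primes contained in a prime quasi-`⋆_f`-maximal ideal. -/
theorem isQuasiPrime_tilde_iff (hinj : Function.Injective (algebraMap R F)) (s : SemistarOp R F)
    {I : Ideal R} :
    IsQuasiPrime s.tilde I ↔
      I.IsPrime ∧ I ≠ ⊥ ∧ ∃ M : Ideal R, IsQuasiMax s.ft M ∧ M.IsPrime ∧ I ≤ M := by
  have key : ∀ r : R, r ∈ idealCon (s.tilde (idealExt I)) ↔
      ∀ M : Ideal R, IsQuasiMax s.ft M → M.IsPrime → ∃ d ∉ M, d * r ∈ I := fun r => by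
    change (∀ M : Ideal R, IsQuasiMax s.ft M → M.IsPrime →
      ∃ d, d ∉ M ∧ d • algebraMap R F r ∈ (idealExt I : Submodule R F)) ↔ _
    simp only [Algebra.smul_def, ← map_mul, algebraMap_mem_idealExt_s12 hinj]
  constructor
  · rintro ⟨hI, h0, hcon⟩
    refine ⟨hI, h0, ?_⟩
    by_contra! hM
    refine hI.ne_top ((Ideal.eq_top_iff_one I).mpr ?_)
    rw [← hcon, key]
    intro M hMmax hMp
    obtain ⟨d, hd, hdM⟩ := SetLike.not_le_iff_exists.mp (hM M hMmax hMp)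
    exact ⟨d, hdM, by simpa using hd⟩
  · rintro ⟨hI, h0, M, hMmax, hMp, hIM⟩
    refine ⟨hI, h0, le_antisymm (fun r hr => ?_) fun r hr => ?_⟩
    · obtain ⟨d, hd, hdr⟩ := (key r).mp hr M hMmax hMp
      exact (hI.mem_or_mem hdr).resolve_left fun hdI => hd (hIM hdI)
    · exact (key r).mpr fun N _ hN =>
        ⟨1, fun h1 => hN.ne_top ((Ideal.eq_top_iff_one N).mpr h1), by simpa using hr⟩

theorem IsQuasiPrime.tilde_of_le (hinj : Function.Injective (algebraMap R F)) {s : SemistarOp R F}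
    {I J : Ideal R} (hJ : IsQuasiPrime s.tilde J) (hI : I.IsPrime) (h0 : I ≠ ⊥) (hIJ : I ≤ J) :
    IsQuasiPrime s.tilde I := by
  obtain ⟨-, -, M, hMmax, hMp, hJM⟩ := (isQuasiPrime_tilde_iff hinj s).mp hJ
  exact (isQuasiPrime_tilde_iff hinj s).mpr ⟨hI, h0, M, hMmax, hMp, hIJ.trans hJM⟩

theorem IsQuasiPrime.ft_ne_star (hinj : Function.Injective (algebraMap R F)) [Nontrivial R]
    {s : SemistarOp R F} {I : Ideal R} (hI : IsQuasiPrime s.tilde I) :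
    s.ft (idealExt I) ≠ s.star (idealExt (⊤ : Ideal R)) := by
  obtain ⟨-, -, M, hMmax, hMp, hIM⟩ := (isQuasiPrime_tilde_iff hinj s).mp hI
  intro heq
  have h1 : algebraMap R F 1 ∈ (idealExt (⊤ : Ideal R) : Submodule R F) :=
    (algebraMap_mem_idealExt_s12 hinj).mpr Submodule.mem_top
  have hne : (idealExt (⊤ : Ideal R) : Submodule R F) ≠ ⊥ := fun h => by
    simp [h] at h1
  have h2 : algebraMap R F 1 ∈ s.ft (idealExt M) :=
    s.ft_mono_s12 (Submodule.map_mono hIM) (heq ▸ s.le_star _ hne h1)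
  refine hMp.ne_top ((Ideal.eq_top_iff_one M).mpr ?_)
  rw [← hMmax.1.2]
  exact h2

theorem QuasiPolyPrime.of_comap_eq (hinj : Function.Injective (algebraMap R F)) [Nontrivial R]
    {s : SemistarOp R F} {n : ℕ} {P : Ideal R} (hP : IsQuasiPrime s.tilde P)
    {Q : Ideal (MvPolynomial (Fin n) R)} (hQ : Q.IsPrime)
    (hQP : Q.comap (algebraMap R (MvPolynomial (Fin n) R)) = P) : QuasiPolyPrime s n Q := by
  refine ⟨?_, hQ, Or.inr (hQP ▸ hP.ft_ne_star hinj)⟩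
  rintro rfl
  refine hP.2.1 (hQP.symm.trans ?_)
  exact Ideal.comap_bot_of_injective _ (MvPolynomial.C_injective _ _)

end QuasiPrimes

section Chains

variable {A : Type*} [CommRing A] {Φ : Ideal A → Prop}

theorem AdjacentFor.mono {Ψ : Ideal A → Prop} {P Q : Ideal A} (h : AdjacentFor Φ P Q)
    (hΨ : ∀ I, Ψ I → Φ I) : AdjacentFor Ψ P Q :=
  ⟨h.1, fun I hI => h.2 I (hΨ I hI)⟩

theorem SaturatedChainFor.two {P I Q : Ideal A} (hP : Φ P) (hI : Φ I) (hQ : Φ Q)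
    (h₁ : AdjacentFor Φ P I) (h₂ : AdjacentFor Φ I Q) : SaturatedChainFor Φ P Q 2 := by
  refine ⟨![P, I, Q], Fin.strictMono_iff_lt_succ.mpr ?_, rfl, rfl, ?_, ?_⟩
  · intro i; fin_cases i; exacts [h₁.1, h₂.1]
  · intro i; fin_cases i; exacts [hP, hI, hQ]
  · intro i; fin_cases i; exacts [h₁, h₂]

theorem SaturatedChainFor.three {P I J Q : Ideal A} (hP : Φ P) (hI : Φ I) (hJ : Φ J) (hQ : Φ Q)
    (h₁ : AdjacentFor Φ P I) (h₂ : AdjacentFor Φ I J) (h₃ : AdjacentFor Φ J Q) :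
    SaturatedChainFor Φ P Q 3 := by
  refine ⟨![P, I, J, Q], Fin.strictMono_iff_lt_succ.mpr ?_, rfl, rfl, ?_, ?_⟩
  · intro i; fin_cases i; exacts [h₁.1, h₂.1, h₃.1]
  · intro i; fin_cases i; exacts [hP, hI, hJ, hQ]
  · intro i; fin_cases i; exacts [h₁, h₂, h₃]

end Chains

namespace MvPolynomial

variable {R : Type*} [CommRing R]

theorem isPrime_map_algebraMap (σ : Type*) (P : Ideal R) [P.IsPrime] :
    (P.map (algebraMap R (MvPolynomial σ R))).IsPrime := by
  have h := ker_map (σ := σ) (Ideal.Quotient.mk P)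
  rw [Ideal.mk_ker] at h
  rw [algebraMap_eq, ← h]
  exact RingHom.ker_isPrime _

theorem comap_map_algebraMap (σ : Type*) (P : Ideal R) :
    (P.map (algebraMap R (MvPolynomial σ R))).comap (algebraMap R (MvPolynomial σ R)) = P := by
  refine le_antisymm (fun r hr => ?_) Ideal.le_comap_map
  simpa using mem_map_C_iff.mp hr 0

theorem comap_comap_constantCoeff (σ : Type*) (P : Ideal R) :
    (P.comap (constantCoeff (σ := σ))).comap (algebraMap R (MvPolynomial σ R)) = P := by
  ext r
  simp [algebraMap_eq]

theorem constantCoeff_surjective (σ : Type*) :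
    Function.Surjective (constantCoeff : MvPolynomial σ R →+* R) :=
  fun r => ⟨C r, constantCoeff_C σ r⟩

theorem map_algebraMap_lt_comap_constantCoeff (σ : Type*) [Nonempty σ] {P : Ideal R}
    (hP : P ≠ ⊤) :
    P.map (algebraMap R (MvPolynomial σ R)) < P.comap (constantCoeff (σ := σ)) := by
  obtain ⟨i⟩ := ‹Nonempty σ›
  refine lt_of_le_of_ne (Ideal.map_le_iff_le_comap.mpr (comap_comap_constantCoeff σ P).ge) ?_
  intro h
  have hX : (X i : MvPolynomial σ R) ∈ P.comap (constantCoeff (σ := σ)) := by simp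
  rw [← h] at hX
  refine hP ((Ideal.eq_top_iff_one P).mpr ?_)
  simpa using mem_map_C_iff.mp hX (Finsupp.single i 1)

theorem adjacentFor_comap_constantCoeff (σ : Type*) {P Q : Ideal R}
    (h : AdjacentFor Ideal.IsPrime P Q) :
    AdjacentFor Ideal.IsPrime (P.comap (constantCoeff (σ := σ)))
      (Q.comap (constantCoeff (σ := σ))) := by
  have hs := constantCoeff_surjective (R := R) σ
  refine ⟨(Ideal.comap_mono h.1.le).lt_of_ne fun he =>
    h.1.ne (Ideal.comap_injective_of_surjective _ hs he), fun I hI hlt => ?_⟩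
  have hker : RingHom.ker (constantCoeff : MvPolynomial σ R →+* R) ≤ I :=
    (Ideal.comap_mono bot_le).trans hlt.1.le
  have hmap := Ideal.map_isPrime_of_surjective hs hker
  have hI' : I = (I.map constantCoeff).comap constantCoeff := by
    rw [Ideal.comap_map_of_surjective _ hs]
    exact (sup_eq_left.mpr hker).symm
  rw [hI'] at hlt
  have hlt_iff : ∀ S T : Ideal R,
      S.comap (constantCoeff (σ := σ)) < T.comap constantCoeff ↔ S < T := fun S T => by
    simp only [lt_iff_le_not_ge, Ideal.comap_le_comap_iff_of_surjective _ hs]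
  exact h.2 _ hmap ⟨(hlt_iff _ _).mp hlt.1, (hlt_iff _ _).mp hlt.2⟩

/-- No three primes of a polynomial ring in one variable in a strict chain have the same
contraction to the base ring. -/
theorem not_lt_of_comap_eq {σ : Type*} [Unique σ] (p : Ideal R)
    {I J K : Ideal (MvPolynomial σ R)} (hI : I.IsPrime) (hJ : J.IsPrime) (hK : K.IsPrime)
    (hIp : I.comap (algebraMap R (MvPolynomial σ R)) = p)
    (hJp : J.comap (algebraMap R (MvPolynomial σ R)) = p)
    (hKp : K.comap (algebraMap R (MvPolynomial σ R)) = p) (hIJ : I < J) : ¬ J < K := by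
  intro hJK
  have hp : p.IsPrime := hIp ▸ Ideal.comap_isPrime _ I
  let q : PrimeSpectrum R := ⟨p, hp⟩
  have hdim : Order.krullDim (PrimeSpectrum.comap (algebraMap R (MvPolynomial σ R)) ⁻¹' {q}) ≤
      (1 : ℕ) := by
    rw [Order.krullDim_eq_of_orderIso
      (PrimeSpectrum.preimageOrderIsoFiber R (MvPolynomial σ R) q), ← ringKrullDim,
      ringKrullDim_eq_of_ringEquiv ((algebraTensorAlgEquiv R p.ResidueField (σ := σ)).trans
        (uniqueAlgEquiv p.ResidueField σ)).toRingEquiv, ← Ring.krullDimLE_iff]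
    infer_instance
  let c : LTSeries (PrimeSpectrum.comap (algebraMap R (MvPolynomial σ R)) ⁻¹' {q}) :=
    { length := 2
      toFun := ![⟨⟨I, hI⟩, PrimeSpectrum.ext hIp⟩, ⟨⟨J, hJ⟩, PrimeSpectrum.ext hJp⟩,
        ⟨⟨K, hK⟩, PrimeSpectrum.ext hKp⟩]
      step := fun i => by fin_cases i; exacts [hIJ, hJK] }
  have hc := (Order.LTSeries.length_le_krullDim c).trans hdim
  have : (2 : ℕ) ≤ 1 := by exact_mod_cast hc
  omega

/-- A prime lying strictly above another prime with the same contraction to the base ring is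
adjacent to it, for polynomials in one variable. -/
theorem adjacentFor_of_comap_eq {σ : Type*} [Unique σ] {p : Ideal R}
    {I J : Ideal (MvPolynomial σ R)} (hI : I.IsPrime) (hJ : J.IsPrime)
    (hIp : I.comap (algebraMap R (MvPolynomial σ R)) = p)
    (hJp : J.comap (algebraMap R (MvPolynomial σ R)) = p) (hIJ : I < J) :
    AdjacentFor Ideal.IsPrime I J := by
  refine ⟨hIJ, fun K hK hlt => not_lt_of_comap_eq p hI hK hJ hIp ?_ hJp hlt.1 hlt.2⟩
  exact le_antisymm (hJp ▸ Ideal.comap_mono hlt.2.le) (hIp ▸ Ideal.comap_mono hlt.1.le)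

/-- Let `P ⊂ Q` be adjacent primes of `R`. A prime strictly between `P[X]` and `Q[X]` contracts
to `P` and is adjacent to `Q[X]`. -/
theorem comap_eq_and_adjacentFor_map {σ : Type*} [Unique σ] {P Q : Ideal R} (hP : P.IsPrime)
    (hPQ : AdjacentFor Ideal.IsPrime P Q) {I : Ideal (MvPolynomial σ R)} (hI : I.IsPrime)
    (hPI : P.map (algebraMap R (MvPolynomial σ R)) < I)
    (hIQ : I < Q.map (algebraMap R (MvPolynomial σ R))) :
    I.comap (algebraMap R (MvPolynomial σ R)) = P ∧
      AdjacentFor Ideal.IsPrime I (Q.map (algebraMap R (MvPolynomial σ R))) := by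
  have key : ∀ J : Ideal (MvPolynomial σ R), J.IsPrime →
      P.map (algebraMap R (MvPolynomial σ R)) < J →
      J < Q.map (algebraMap R (MvPolynomial σ R)) →
      J.comap (algebraMap R (MvPolynomial σ R)) = P := by
    intro J hJ hPJ hJQ
    have hle : P ≤ J.comap (algebraMap R (MvPolynomial σ R)) :=
      Ideal.map_le_iff_le_comap.mp hPJ.le
    have hle' : J.comap (algebraMap R (MvPolynomial σ R)) ≤ Q :=
      (Ideal.comap_mono hJQ.le).trans (comap_map_algebraMap σ Q).le
    by_contra hne
    refine hPQ.2 _ (Ideal.comap_isPrime _ J) ⟨hle.lt_of_ne (Ne.symm hne), hle'.lt_of_ne ?_⟩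
    intro heq
    exact hJQ.not_ge (Ideal.map_le_iff_le_comap.mpr heq.ge)
  refine ⟨key I hI hPI hIQ, hIQ, fun J hJ hlt => ?_⟩
  exact not_lt_of_comap_eq P (isPrime_map_algebraMap σ P) hI hJ (comap_map_algebraMap σ P)
    (key I hI hPI hIQ) (key J hJ (hPI.trans hlt.1) hlt.2) hPI hlt.1

end MvPolynomial

open MvPolynomial in
/-- If `D[X₁]` is `⋆[1]`-catenary, then `D` is a `⋆̃`-strong
S-domain. -/
theorem polyCatenary_one_isTildeStrongS (D : Type*) [CommRing D] [IsDomain D]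
    (s : SemistarOp D (FractionRing D)) (h : PolyCatenary s 1) :
    TildeStrongSDomain s := by
  intro P Q hP hQ hPQ
  have hinj := IsFractionRing.injective D (FractionRing D)
  have hPp : P.IsPrime := hP.1
  have hQp : Q.IsPrime := hQ.1
  have hadj : AdjacentFor Ideal.IsPrime P Q := by
    refine ⟨hPQ.1, fun I hI hlt => hPQ.2 I (hQ.tilde_of_le hinj hI ?_ hlt.2.le) hlt⟩
    exact (bot_le.trans_lt hlt.1).ne'
  have hmP := isPrime_map_algebraMap (Fin 1) P
  have hmQ := isPrime_map_algebraMap (Fin 1) Q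
  have hcP := Ideal.comap_isPrime (constantCoeff (σ := Fin 1)) P
  have hcQ := Ideal.comap_isPrime (constantCoeff (σ := Fin 1)) Q
  have emP := comap_map_algebraMap (Fin 1) P
  have emQ := comap_map_algebraMap (Fin 1) Q
  have ecP := comap_comap_constantCoeff (Fin 1) P
  have ecQ := comap_comap_constantCoeff (Fin 1) Q
  have qmP := QuasiPolyPrime.of_comap_eq hinj hP hmP emP
  have qmQ := QuasiPolyPrime.of_comap_eq hinj hQ hmQ emQ
  have qcP := QuasiPolyPrime.of_comap_eq hinj hP hcP ecP
  have qcQ := QuasiPolyPrime.of_comap_eq hinj hQ hcQ ecQ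
  have hlt : P.map (algebraMap D (MvPolynomial (Fin 1) D)) <
      Q.map (algebraMap D (MvPolynomial (Fin 1) D)) := by
    refine (Ideal.map_mono hPQ.1.le).lt_of_ne fun heq => hPQ.1.ne ?_
    rw [← emP, heq, emQ]
  refine ⟨qmP, qmQ, hlt, fun I hI ⟨hPI, hIQ⟩ => ?_⟩
  obtain ⟨eI, adjIQ⟩ := comap_eq_and_adjacentFor_map hPp hadj hI.2.1 hPI hIQ
  have hprime : ∀ J : Ideal (MvPolynomial (Fin 1) D), QuasiPolyPrime s 1 J → J.IsPrime :=
    fun J hJ => hJ.2.1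
  have hltP := map_algebraMap_lt_comap_constantCoeff (Fin 1) hPp.ne_top
  have hltQ := map_algebraMap_lt_comap_constantCoeff (Fin 1) hQp.ne_top
  have adjP := (adjacentFor_of_comap_eq hmP hcP emP ecP hltP).mono hprime
  have adjPQ := (adjacentFor_comap_constantCoeff (Fin 1) hadj).mono hprime
  have adjPI := (adjacentFor_of_comap_eq hmP hI.2.1 emP eI hPI).mono hprime
  have adjQ := (adjacentFor_of_comap_eq hmQ hcQ emQ ecQ hltQ).mono hprime
  have := h _ _ qmP qcQ (hlt.trans hltQ) 2 3 (.two qmP qcP qcQ adjP adjPQ)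
    (.three qmP hI qmQ qcQ adjPI (adjIQ.mono hprime) adjQ)
  omega
end
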